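/- arXiv:2405.12655 — 2 statements merged into one kernel-verified Lean document; each statement's English description precedes it below -/
import Mathlib

section
/- Let f : E → ℝ be Lipschitz with constant L > 0, let x̄ ∈ E be a global minimizer of f, let α > 0 and γ₀ > 0. Then there exists a constant C > 0, depending only on L, α and γ₀, with the following property. Suppose (x_k)_{k≥0} is a sequence in E such that f(x₀) − f(x̄) ≤ γ₀, such that Γf(x) ≥ α‖x − x̄‖ holds for every x with f(x) ≤ f(x₀), and such that for every k the point x_k is not Clarke-critical and x_{k+1} = x_k − (ε_k/‖g_{ε_k}(x_k)‖)·g_{ε_k}(x_k) for some radius ε_k with (1/2)·Γf(x_k) ≤ ε_k < Γf(x_k). Define the oracle-call counts n_j := 2 + ⌊log₂ L − log₂ Γf(x_j)⌋ and s_k := n_0 + n_1 + ⋯ + n_k. Then for every k ≥ 1, f(x_k) − f(x̄) ≤ C·(log s_k)/s_k. -/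
open Filter Topology Metric Set
open scoped Classical

variable {E : Type*} [NormedAddCommGroup E] [InnerProductSpace ℝ E] [FiniteDimensional ℝ E]

/-- The Clarke subdifferential: the closed convex hull of all limits of gradients
along sequences of points of differentiability converging to `x`. -/
noncomputable def clarkeSubdiff (f : E → ℝ) (x : E) : Set E :=
  closure (convexHull ℝ {v : E | ∃ u : ℕ → E,
    (∀ n, DifferentiableAt ℝ f (u n)) ∧
    Tendsto u atTop (𝓝 x) ∧
    Tendsto (fun n => gradient f (u n)) atTop (𝓝 v)})

/-- The Goldstein subdifferential of radius `ε`. -/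
noncomputable def goldsteinSubdiff (f : E → ℝ) (x : E) (ε : ℝ) : Set E :=
  convexHull ℝ (⋃ y ∈ Metric.closedBall x ε, clarkeSubdiff f y)

/-- The element of minimal norm of a set (junk value `0` if no minimizer exists). -/
noncomputable def minNorm (s : Set E) : E :=
  if h : ∃ v, v ∈ s ∧ ∀ w ∈ s, ‖v‖ ≤ ‖w‖ then h.choose else 0

/-- The Goldstein subgradient: the minimal-norm element of the Goldstein subdifferential. -/
noncomputable def goldsteinGrad (f : E → ℝ) (x : E) (ε : ℝ) : E :=
  minNorm (goldsteinSubdiff f x ε)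

/-- The Goldstein modulus `Γf(x) = inf {ε ≥ 0 : ‖g_ε(x)‖ ≤ ε}`. -/
noncomputable def goldsteinModulus (f : E → ℝ) (x : E) : ℝ :=
  sInf {ε : ℝ | 0 ≤ ε ∧ ‖goldsteinGrad f x ε‖ ≤ ε}

open MeasureTheory in
/-- A Lipschitz function whose gradients, near a segment, have inner product at most `c` with the
direction `d` of the segment grows at rate at most `c` along the segment. -/
theorem LipschitzWith.sub_le_of_inner_gradient_le {K : NNReal} {f : E → ℝ}
    (hf : LipschitzWith K f) {x d : E} (hd : ‖d‖ ≤ 1) {ε r c : ℝ} (hε : 0 ≤ ε) (hr : 0 < r)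
    (h : ∀ z, dist z x < ε + r → DifferentiableAt ℝ f z → inner ℝ (gradient f z) d ≤ c) :
    f (x + ε • d) - f x ≤ c * ε := by
  borelize E
  have hae : ∀ᵐ y : E, ∀ᵐ t : ℝ, DifferentiableAt ℝ f (y + t • d) :=
    (ae_ae_add_linearMap_mem_iff (LinearMap.toSpanSingleton ℝ E d) volume volume
      (measurableSet_of_differentiableAt ℝ f)).2 hf.ae_differentiableAt
  have key : ∀ y ∈ ball x r, (∀ᵐ t : ℝ, DifferentiableAt ℝ f (y + t • d)) →
      f (y + ε • d) - f y ≤ c * ε := by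
    intro y hy hyt
    set φ : ℝ → ℝ := fun t => f (y + t • d) with hφ
    have hlip : LipschitzWith K φ := by
      refine LipschitzWith.of_dist_le_mul fun s t => ?_
      refine (hf.dist_le_mul _ _).trans ?_
      gcongr
      rw [dist_add_left, dist_eq_norm, ← sub_smul, norm_smul, ← dist_eq_norm]
      exact mul_le_of_le_one_right dist_nonneg hd
    have hac : AbsolutelyContinuousOnInterval φ 0 ε :=
      hlip.lipschitzOnWith.absolutelyContinuousOnInterval
    have hint := hac.integral_deriv_eq_sub
    have hle : ∫ t in (0 : ℝ)..ε, deriv φ t ≤ ∫ _ in (0 : ℝ)..ε, c := by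
      refine intervalIntegral.integral_mono_ae_restrict hε hac.intervalIntegrable_deriv
        intervalIntegrable_const ?_
      filter_upwards [ae_restrict_of_ae hyt, ae_restrict_mem measurableSet_Icc] with t ht htI
      have hder : HasDerivAt φ (inner ℝ (gradient f (y + t • d)) d) t := by
        have h1 : HasDerivAt (fun t : ℝ => y + t • d) d t := by
          simpa using ((hasDerivAt_id t).smul_const d).const_add y
        exact ht.hasGradientAt.hasFDerivAt.comp_hasDerivAt t h1
      rw [hder.deriv]
      refine h _ ?_ ht
      calc dist (y + t • d) x ≤ dist (y + t • d) y + dist y x := dist_triangle _ _ _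
        _ = |t| * ‖d‖ + dist y x := by simp [dist_eq_norm, norm_smul]
        _ < ε + r := by
          rw [abs_of_nonneg htI.1]
          have := mul_le_mul htI.2 hd (norm_nonneg d) hε
          have := mem_ball.1 hy
          linarith
    rw [hint] at hle
    simpa [hφ, mul_comm] using hle
  have hcl : x ∈ closure (ball x r ∩ {y | ∀ᵐ t : ℝ, DifferentiableAt ℝ f (y + t • d)}) :=
    (Measure.dense_of_ae hae).open_subset_closure_inter isOpen_ball (mem_ball_self hr)
  have hclosed : IsClosed {y | f (y + ε • d) - f y ≤ c * ε} := by
    have := hf.continuous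
    exact isClosed_le (by fun_prop) continuous_const
  exact closure_minimal (fun y hy => key y hy.1 hy.2) hclosed hcl

theorem LipschitzWith.norm_gradient_le {K : NNReal} {f : E → ℝ} (hf : LipschitzWith K f) (x : E) :
    ‖gradient f x‖ ≤ K := by
  rw [← (InnerProductSpace.toDual ℝ E).norm_map, toDual_gradient]
  exact norm_fderiv_le_of_lipschitz ℝ hf

theorem LipschitzWith.goldsteinSubdiff_subset {K : NNReal} {f : E → ℝ} (hf : LipschitzWith K f)
    (x : E) (ε : ℝ) : goldsteinSubdiff f x ε ⊆ closedBall 0 K := by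
  refine convexHull_min (iUnion₂_subset fun y _ => ?_) (convex_closedBall _ _)
  refine closure_minimal (convexHull_min ?_ (convex_closedBall _ _)) isClosed_closedBall
  rintro v ⟨u, -, -, hu⟩
  refine isClosed_closedBall.mem_of_tendsto hu (Eventually.of_forall fun n => ?_)
  simpa using hf.norm_gradient_le (u n)

theorem LipschitzWith.norm_goldsteinGrad_le {K : NNReal} {f : E → ℝ} (hf : LipschitzWith K f)
    (x : E) (ε : ℝ) : ‖goldsteinGrad f x ε‖ ≤ K := by
  unfold goldsteinGrad minNorm
  split_ifs with h
  · simpa using hf.goldsteinSubdiff_subset x ε h.choose_spec.1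
  · simp

theorem goldsteinModulus_le {f : E → ℝ} {x : E} {ε : ℝ} (hε : 0 ≤ ε)
    (h : ‖goldsteinGrad f x ε‖ ≤ ε) : goldsteinModulus f x ≤ ε :=
  csInf_le ⟨0, fun _ h => h.1⟩ ⟨hε, h⟩

theorem sq_norm_goldsteinGrad_le_inner {f : E → ℝ} {x : E} {ε : ℝ}
    (h0 : goldsteinGrad f x ε ≠ 0) {v : E} (hv : v ∈ goldsteinSubdiff f x ε) :
    ‖goldsteinGrad f x ε‖ ^ 2 ≤ inner ℝ v (goldsteinGrad f x ε) := by
  have hex : ∃ v, v ∈ goldsteinSubdiff f x ε ∧ ∀ w ∈ goldsteinSubdiff f x ε, ‖v‖ ≤ ‖w‖ := by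
    by_contra hex
    exact h0 (dif_neg hex)
  have hg : goldsteinGrad f x ε = hex.choose := dif_pos hex
  obtain ⟨hmem, hmin⟩ := hex.choose_spec
  rw [← hg] at hmem hmin
  set g := goldsteinGrad f x ε
  have : Nonempty (goldsteinSubdiff f x ε) := ⟨⟨g, hmem⟩⟩
  have hinf : ‖(0 : E) - g‖ = ⨅ w : goldsteinSubdiff f x ε, ‖(0 : E) - w‖ := by
    simp only [zero_sub, norm_neg]
    exact le_antisymm (le_ciInf fun w => hmin w w.2)
      (ciInf_le (f := fun w : goldsteinSubdiff f x ε => ‖(w : E)‖)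
        ⟨0, by rintro _ ⟨w, rfl⟩; exact norm_nonneg _⟩ ⟨g, hmem⟩)
  have := (norm_eq_iInf_iff_real_inner_le_zero (convex_convexHull ℝ _) hmem).1 hinf v hv
  rw [zero_sub, inner_neg_left, inner_sub_right, real_inner_self_eq_norm_sq,
    real_inner_comm] at this
  linarith

/-- Limits of gradients taken at points approaching a closed ball belong to the Goldstein
subdifferential, so an upper bound on the latter nearly holds for gradients near the ball. -/
theorem LipschitzWith.exists_inner_gradient_le {K : NNReal} {f : E → ℝ} (hf : LipschitzWith K f)
    {x d : E} {ε c c' : ℝ} (hc : c < c') (h : ∀ v ∈ goldsteinSubdiff f x ε, inner ℝ v d ≤ c) :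
    ∃ r > 0, ∀ z, dist z x < ε + r → DifferentiableAt ℝ f z → inner ℝ (gradient f z) d ≤ c' := by
  by_contra! hcon
  choose! z hzx hzd hz using fun n : ℕ => hcon (1 / ((n : ℝ) + 1)) (by positivity)
  have hzb : ∀ n, (z n, gradient f (z n)) ∈ closedBall x (ε + 1) ×ˢ closedBall (0 : E) K := by
    intro n
    refine ⟨mem_closedBall.2 ((hzx n).le.trans ?_), by simpa using hf.norm_gradient_le (z n)⟩
    have : 1 / ((n : ℝ) + 1) ≤ 1 := by
      rw [div_le_one (by positivity)]
      linarith [(Nat.cast_nonneg n : (0 : ℝ) ≤ n)]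
    linarith
  obtain ⟨⟨y, v⟩, -, φ, hφ, hlim⟩ :=
    ((isCompact_closedBall x (ε + 1)).prod (isCompact_closedBall (0 : E) K)).tendsto_subseq hzb
  have hy : Tendsto (fun n => z (φ n)) atTop (𝓝 y) := (continuous_fst.tendsto _).comp hlim
  have hv : Tendsto (fun n => gradient f (z (φ n))) atTop (𝓝 v) :=
    (continuous_snd.tendsto _).comp hlim
  have hyx : dist y x ≤ ε := by
    have h1 : Tendsto (fun n => ε + 1 / ((φ n : ℝ) + 1)) atTop (𝓝 (ε + 0)) :=
      (tendsto_one_div_add_atTop_nhds_zero_nat.comp hφ.tendsto_atTop).const_add ε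
    rw [add_zero] at h1
    exact le_of_tendsto_of_tendsto' (hy.dist tendsto_const_nhds) h1 fun n => (hzx (φ n)).le
  have hmem : v ∈ goldsteinSubdiff f x ε :=
    subset_convexHull ℝ _ <| mem_iUnion₂.2 ⟨y, hyx, subset_closure <| subset_convexHull ℝ _
      ⟨fun n => z (φ n), fun n => hzd (φ n), hy, hv⟩⟩
  have : c' ≤ inner ℝ v d :=
    ge_of_tendsto' (hv.inner tendsto_const_nhds) fun n => (hz (φ n)).le
  linarith [h v hmem]

/-- Descent along the normalized Goldstein subgradient. -/
theorem LipschitzWith.goldstein_descent {K : NNReal} {f : E → ℝ} (hf : LipschitzWith K f)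
    {x : E} {ε : ℝ} (hε : 0 ≤ ε) (h0 : goldsteinGrad f x ε ≠ 0) :
    f (x - (ε / ‖goldsteinGrad f x ε‖) • goldsteinGrad f x ε) ≤
      f x - ε * ‖goldsteinGrad f x ε‖ := by
  have hin := fun v hv => sq_norm_goldsteinGrad_le_inner (v := v) h0 hv
  set g := goldsteinGrad f x ε
  have hg : 0 < ‖g‖ := norm_pos_iff.2 h0
  set d : E := -(‖g‖⁻¹ • g) with hd_def
  have hd : ‖d‖ ≤ 1 := by
    rw [hd_def, norm_neg, norm_smul, norm_inv, norm_norm, inv_mul_cancel₀ hg.ne']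
  have hstep : x - (ε / ‖g‖) • g = x + ε • d := by
    rw [hd_def, smul_neg, smul_smul, sub_eq_add_neg, div_eq_mul_inv]
  have hdir : ∀ v ∈ goldsteinSubdiff f x ε, inner ℝ v d ≤ -‖g‖ := by
    intro v hv
    rw [hd_def, inner_neg_right, real_inner_smul_right, neg_le_neg_iff, inv_mul_eq_div,
      le_div_iff₀ hg, ← sq]
    exact hin v hv
  rw [hstep]
  refine le_of_forall_pos_le_add fun η hη => ?_
  obtain ⟨r, hr, hgrad⟩ := hf.exists_inner_gradient_le
    (c' := -‖g‖ + η / (ε + 1)) (by linarith [div_pos hη (by linarith : 0 < ε + 1)]) hdir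
  have hle := hf.sub_le_of_inner_gradient_le hd hε hr hgrad
  have : η / (ε + 1) * ε ≤ η := by
    rw [div_mul_eq_mul_div, div_le_iff₀ (by linarith)]
    nlinarith
  linarith

/-- A nonnegative sequence with `u (k + 1) ≤ u k - c * u k ^ 2` decays like `1 / (c * k)`. -/
theorem natCast_mul_mul_le_one_of_le_sub_sq {u : ℕ → ℝ} {c : ℝ} (hc : 0 ≤ c) (hu : ∀ k, 0 ≤ u k)
    (hstep : ∀ k, u (k + 1) ≤ u k - c * u k ^ 2) (k : ℕ) : k * (c * u k) ≤ 1 := by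
  induction k with
  | zero => simp
  | succ k ih =>
    have hk : (0 : ℝ) ≤ k := k.cast_nonneg
    have hw : 0 ≤ c * u k := mul_nonneg hc (hu k)
    have h1 : c * u (k + 1) ≤ c * u k - (c * u k) ^ 2 := by
      nlinarith [mul_le_mul_of_nonneg_left (hstep k) hc]
    have h2 : 0 ≤ c * u (k + 1) := mul_nonneg hc (hu _)
    generalize c * u k = w at *
    generalize c * u (k + 1) = w' at *
    have hw1 : w ≤ 1 := by nlinarith
    push_cast
    nlinarith [mul_nonneg (sub_nonneg.2 ih) (sub_nonneg.2 hw1),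
      mul_le_mul_of_nonneg_left h1 (by linarith : (0 : ℝ) ≤ k + 1)]

theorem stmt8 (L α γ₀ : ℝ) (hL : 0 < L) (hα : 0 < α) (hγ₀ : 0 < γ₀) :
    ∃ C > 0, ∀ (f : E → ℝ), LipschitzWith L.toNNReal f →
      ∀ xbar : E, (∀ y : E, f xbar ≤ f y) →
      ∀ x : ℕ → E, f (x 0) - f xbar ≤ γ₀ →
      (∀ y : E, f y ≤ f (x 0) → α * ‖y - xbar‖ ≤ goldsteinModulus f y) →
      (∀ k : ℕ, (0 : E) ∉ clarkeSubdiff f (x k) ∧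
        ∃ ε : ℝ, goldsteinModulus f (x k) / 2 ≤ ε ∧ ε < goldsteinModulus f (x k) ∧
          x (k + 1) =
            x k - (ε / ‖goldsteinGrad f (x k) ε‖) • goldsteinGrad f (x k) ε) →
      ∀ k : ℕ, 1 ≤ k →
        f (x k) - f xbar ≤
          C * Real.log ((((∑ j ∈ Finset.range (k + 1),
                (2 + ⌊Real.logb 2 L - Real.logb 2 (goldsteinModulus f (x j))⌋)) : ℤ) : ℝ)) /
            (((∑ j ∈ Finset.range (k + 1),
                (2 + ⌊Real.logb 2 L - Real.logb 2 (goldsteinModulus f (x j))⌋)) : ℤ) : ℝ) := by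
  set c : ℝ := (α / L) ^ 2 / 4 with hc_def
  set M : ℝ := 2 + (|Real.log (L ^ 2 / α)| + 1) / Real.log 2 with hM_def
  have hc : 0 < c := by positivity
  have hlog2 : 0 < Real.log 2 := Real.log_pos one_lt_two
  have hM : 0 < M := by positivity
  refine ⟨1 + 2 * M / c, by positivity, ?_⟩
  intro f hf xbar hmin x _ hgrowth hx k hk
  have hLcoe : (L.toNNReal : ℝ) = L := Real.coe_toNNReal L hL.le
  set Γ : ℕ → ℝ := fun j => goldsteinModulus f (x j) with hΓ
  set u : ℕ → ℝ := fun j => f (x j) - f xbar with hu_def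
  have hu : ∀ j, 0 ≤ u j := fun j => sub_nonneg.2 (hmin _)
  have hΓpos : ∀ j, 0 < Γ j := by
    intro j
    obtain ⟨-, ε, h1, h2, -⟩ := hx j
    change Γ j / 2 ≤ ε at h1
    change ε < Γ j at h2
    linarith
  have hΓL : ∀ j, Γ j ≤ L := fun j =>
    goldsteinModulus_le hL.le ((hf.norm_goldsteinGrad_le (x j) L).trans_eq hLcoe)
  have hdesc : ∀ j, u (j + 1) ≤ u j - Γ j ^ 2 / 4 := by
    intro j
    obtain ⟨-, ε, h1, h2, h3⟩ := hx j
    have h1 : Γ j / 2 ≤ ε := h1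
    have hε : 0 < ε := by linarith [hΓpos j]
    have hg : ε < ‖goldsteinGrad f (x j) ε‖ := by
      by_contra! hle
      exact h2.not_ge (goldsteinModulus_le hε.le hle)
    have hd := hf.goldstein_descent hε.le (norm_pos_iff.1 (hε.trans hg))
    rw [← h3] at hd
    simp only [hu_def]
    nlinarith [hΓpos j, mul_le_mul_of_nonneg_left hg.le hε.le]
  have hanti : Antitone u := antitone_nat_of_succ_le fun j => by
    linarith [hdesc j, sq_nonneg (Γ j)]
  have hΓu : ∀ j, α / L * u j ≤ Γ j := by
    intro j
    have h1 : f (x j) ≤ f (x 0) := by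
      have := hanti (Nat.zero_le j)
      simp only [hu_def] at this
      linarith
    have h2 : u j ≤ L * ‖x j - xbar‖ := by
      have := hf.dist_le_mul (x j) xbar
      rw [hLcoe, Real.dist_eq, dist_eq_norm] at this
      exact (le_abs_self _).trans this
    calc α / L * u j ≤ α / L * (L * ‖x j - xbar‖) := by gcongr
      _ = α * ‖x j - xbar‖ := by field_simp
      _ ≤ Γ j := hgrowth _ h1
  have hrate : k * (c * u k) ≤ 1 := by
    refine natCast_mul_mul_le_one_of_le_sub_sq hc.le hu (fun j => (hdesc j).trans ?_) k
    have := pow_le_pow_left₀ (mul_nonneg (by positivity) (hu j)) (hΓu j) 2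
    rw [hc_def]
    nlinarith
  have hk1 : (1 : ℝ) ≤ k := by exact_mod_cast hk
  set s : ℝ := ((∑ j ∈ Finset.range (k + 1), (2 + ⌊Real.logb 2 L - Real.logb 2 (Γ j)⌋) : ℤ) : ℝ)
    with hs_def
  have hs4 : 4 ≤ s := by
    have h1 : ∀ j ∈ Finset.range (k + 1), (2 : ℤ) ≤ 2 + ⌊Real.logb 2 L - Real.logb 2 (Γ j)⌋ := by
      intro j _
      have : 0 ≤ ⌊Real.logb 2 L - Real.logb 2 (Γ j)⌋ :=
        Int.floor_nonneg.2 (sub_nonneg.2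
          (Real.logb_le_logb_of_le one_lt_two (hΓpos j) (hΓL j)))
      linarith
    have h2 := Finset.card_nsmul_le_sum _ _ _ h1
    have h3 : (4 : ℤ) ≤ ∑ j ∈ Finset.range (k + 1),
        (2 + ⌊Real.logb 2 L - Real.logb 2 (Γ j)⌋) := by
      refine le_trans ?_ h2
      simp only [Finset.card_range, nsmul_eq_mul]
      push_cast
      omega
    rw [hs_def]
    exact_mod_cast h3
  have hs : 0 < s := by linarith
  have hlogs : 1 ≤ Real.log s := by
    rw [Real.le_log_iff_exp_le hs]
    linarith [Real.exp_one_lt_d9]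
  change u k ≤ (1 + 2 * M / c) * Real.log s / s
  rw [le_div_iff₀ hs]
  have hMc : 0 < 2 * M / c := by positivity
  rcases le_or_gt (u k * s) 1 with hcase | hcase
  · nlinarith
  have hn : ∀ j ∈ Finset.range (k + 1),
      ((2 + ⌊Real.logb 2 L - Real.logb 2 (Γ j)⌋ : ℤ) : ℝ) ≤ M * Real.log s := by
    intro j hj
    have hjk : u k ≤ u j := hanti (Nat.lt_succ_iff.1 (Finset.mem_range.1 hj))
    have hΓs : L / Γ j ≤ L ^ 2 / α * s := by
      rw [div_le_iff₀ (hΓpos j)]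
      have h1 : α / L * u k ≤ Γ j :=
        (mul_le_mul_of_nonneg_left hjk (by positivity)).trans (hΓu j)
      calc L ≤ L * (u k * s) := le_mul_of_one_le_right hL.le hcase.le
        _ = L ^ 2 / α * s * (α / L * u k) := by field_simp
        _ ≤ L ^ 2 / α * s * Γ j := by gcongr
    have hlog : Real.log (L / Γ j) ≤ (|Real.log (L ^ 2 / α)| + 1) * Real.log s := by
      have h1 := Real.log_le_log (div_pos hL (hΓpos j)) hΓs
      rw [Real.log_mul (by positivity) hs.ne'] at h1
      nlinarith [le_abs_self (Real.log (L ^ 2 / α)), abs_nonneg (Real.log (L ^ 2 / α))]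
    have hfl := Int.floor_le (Real.logb 2 L - Real.logb 2 (Γ j))
    rw [← Real.logb_div hL.ne' (hΓpos j).ne', Real.logb] at hfl
    have hdiv : Real.log (L / Γ j) / Real.log 2 ≤
        (|Real.log (L ^ 2 / α)| + 1) / Real.log 2 * Real.log s := by
      rw [div_mul_eq_mul_div]
      gcongr
    rw [← Real.logb_div hL.ne' (hΓpos j).ne', Real.logb]
    push_cast
    rw [hM_def]
    linarith
  have hsum : s ≤ (k + 1) * (M * Real.log s) := by
    have h1 := Finset.sum_le_card_nsmul _ _ _ hn
    rw [← Int.cast_sum, ← hs_def] at h1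
    simpa using h1
  have hkc : (k + 1) * u k ≤ 2 / c := by
    rw [le_div_iff₀ hc]
    nlinarith [mul_nonneg hc.le (hu k)]
  have hlM : 0 ≤ M * Real.log s := by positivity
  calc u k * s ≤ u k * ((k + 1) * (M * Real.log s)) := mul_le_mul_of_nonneg_left hsum (hu k)
    _ = (k + 1) * u k * (M * Real.log s) := by ring
    _ ≤ 2 / c * (M * Real.log s) := mul_le_mul_of_nonneg_right hkc hlM
    _ = 2 * M / c * Real.log s := by ring
    _ ≤ (1 + 2 * M / c) * Real.log s := by nlinarith
end

section
/- Suppose f : E → ℝ is locally Lipschitz and is a strong C² max function at x̄ with data f₁, …, f_n. Then the Goldstein modulus of f grows linearly at x̄: there exist constants α > 0 and ρ > 0 such that Γf(x) ≥ α·‖x − x̄‖ for every x with ‖x − x̄‖ ≤ ρ. -/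
open Filter Topology Metric Set
open scoped Classical

variable {E : Type*} [NormedAddCommGroup E] [InnerProductSpace ℝ E] [FiniteDimensional ℝ E]

open scoped RealInnerProductSpace

/-- `f` is a strong `C²` max function at `xbar` with data `F 0, …, F n`. -/
def IsStrongC2MaxAt (f : E → ℝ) (xbar : E) {n : ℕ} (F : Fin (n + 1) → E → ℝ) : Prop :=
  (∀ i, ContDiff ℝ 2 (F i)) ∧
  (∃ ρ > 0, ∀ x : E, ‖x - xbar‖ ≤ ρ →
      f x = Finset.univ.sup' Finset.univ_nonempty (fun i => F i x)) ∧
  (∀ i j, F i xbar = F j xbar) ∧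
  AffineIndependent ℝ (fun i => gradient (F i) xbar) ∧
  (0 : E) ∈ intrinsicInterior ℝ (convexHull ℝ (Set.range fun i => gradient (F i) xbar)) ∧
  (∃ δ > 0, ∃ ρ' > 0, ∀ x : E, ‖x - xbar‖ ≤ ρ' → f x - f xbar ≥ δ / 2 * ‖x - xbar‖ ^ 2)

theorem isCompact_convexHull_of_isCompact {K : Set E} (hK : IsCompact K) :
    IsCompact (convexHull ℝ K) := by
  let Φ (k : ℕ) (p : (Fin k → ℝ) × (Fin k → E)) : E := ∑ i, p.1 i • p.2 i
  have hΦ (k : ℕ) : IsCompact (Φ k '' (stdSimplex ℝ (Fin k) ×ˢ Set.univ.pi fun _ => K)) := by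
    refine ((isCompact_stdSimplex ℝ (Fin k)).prod (isCompact_univ_pi fun _ => hK)).image ?_
    fun_prop
  convert (Finset.range (Module.finrank ℝ E + 2)).isCompact_biUnion fun k _ => hΦ k
  ext x
  simp only [Set.mem_iUnion, Finset.mem_range, exists_prop]
  constructor
  · intro hx
    obtain ⟨ι, _, z, w, hz, hind, hw, hw1, rfl⟩ := eq_pos_convex_span_of_mem_convexHull hx
    refine ⟨Fintype.card ι, ?_,
      ⟨(w ∘ (Fintype.equivFin ι).symm, z ∘ (Fintype.equivFin ι).symm), ⟨⟨?_, ?_⟩, ?_⟩, ?_⟩⟩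
    · have h1 := hind.card_le_finrank_succ
      have h2 := (vectorSpan ℝ (Set.range z)).finrank_le
      omega
    · exact fun i => (hw _).le
    · rw [← hw1]
      exact (Fintype.equivFin ι).symm.sum_comp w
    · exact fun i _ => hz ⟨_, rfl⟩
    · exact (Fintype.equivFin ι).symm.sum_comp fun i => w i • z i
  · rintro ⟨k, -, ⟨w, z⟩, ⟨hw, hz⟩, rfl⟩
    exact (convex_convexHull ℝ K).sum_mem (fun i _ => hw.1 i) hw.2
      fun i _ => subset_convexHull ℝ K (hz i trivial)

theorem minNorm_mem {V : Type*} [NormedAddCommGroup V]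
    {s : Set V} (hs : IsCompact s) (hne : s.Nonempty) : minNorm s ∈ s := by
  obtain ⟨v, hv, hmin⟩ := hs.exists_isMinOn hne continuous_norm.continuousOn
  have h : ∃ v, v ∈ s ∧ ∀ w ∈ s, ‖v‖ ≤ ‖w‖ := ⟨v, hv, fun w hw => hmin hw⟩
  rw [minNorm, dif_pos h]
  exact h.choose_spec.1

theorem norm_minNorm_le {V : Type*} [NormedAddCommGroup V]
    {s : Set V} {w : V} (hw : w ∈ s) : ‖minNorm s‖ ≤ ‖w‖ := by
  rw [minNorm]
  split_ifs with h
  · exact h.choose_spec.2 w hw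
  · simp

/-- The limits of gradients whose closed convex hull is the Clarke subdifferential. -/
def limitingGradients (f : E → ℝ) (x : E) : Set E :=
  {v : E | ∃ u : ℕ → E,
    (∀ n, DifferentiableAt ℝ f (u n)) ∧
    Tendsto u atTop (𝓝 x) ∧
    Tendsto (fun n => gradient f (u n)) atTop (𝓝 v)}

theorem clarkeSubdiff_eq (f : E → ℝ) (x : E) :
    clarkeSubdiff f x = closure (convexHull ℝ (limitingGradients f x)) := rfl

theorem goldsteinSubdiff_mono (f : E → ℝ) (x : E) {ε ε' : ℝ} (h : ε ≤ ε') :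
    goldsteinSubdiff f x ε ⊆ goldsteinSubdiff f x ε' :=
  convexHull_mono (Set.biUnion_subset_biUnion_left (Metric.closedBall_subset_closedBall h))

theorem goldsteinModulus_set_nonempty (f : E → ℝ) (x : E) :
    {ε : ℝ | 0 ≤ ε ∧ ‖goldsteinGrad f x ε‖ ≤ ε}.Nonempty := by
  rcases (goldsteinSubdiff f x 0).eq_empty_or_nonempty with h | ⟨v, hv⟩
  · refine ⟨0, le_rfl, ?_⟩
    simp [goldsteinGrad, h, minNorm]
  · exact ⟨‖v‖, norm_nonneg v,
      norm_minNorm_le (goldsteinSubdiff_mono f x (norm_nonneg v) hv)⟩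

theorem mem_limitingGradients_iff {f : E → ℝ} {x v : E} :
    v ∈ limitingGradients f x ↔
      (x, v) ∈ closure {p : E × E | DifferentiableAt ℝ f p.1 ∧ p.2 = gradient f p.1} := by
  rw [mem_closure_iff_seq_limit]
  constructor
  · rintro ⟨u, hd, hu, hg⟩
    exact ⟨fun n => (u n, gradient f (u n)), fun n => ⟨hd n, rfl⟩, hu.prodMk_nhds hg⟩
  · rintro ⟨p, hp, hlim⟩
    refine ⟨fun n => (p n).1, fun n => (hp n).1, (continuous_fst.tendsto _).comp hlim, ?_⟩
    simp_rw [← (hp _).2]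
    exact (continuous_snd.tendsto _).comp hlim

theorem norm_gradient_le_of_lipschitzOnWith {V : Type*} [NormedAddCommGroup V] [InnerProductSpace ℝ V] [CompleteSpace V]
    {f : V → ℝ} {s : Set V} {K : NNReal}
    (hf : LipschitzOnWith K f s) {x : V} (hs : s ∈ 𝓝 x) : ‖gradient f x‖ ≤ K := by
  rw [gradient, LinearIsometryEquiv.norm_map]
  exact norm_fderiv_le_of_lipschitzOn ℝ hs hf

theorem isCompact_iUnion_limitingGradients {f : E → ℝ} {s : Set E} {K : NNReal}
    (hf : LipschitzOnWith K f s) (hs : IsOpen s) {B : Set E} (hB : IsCompact B) (hBs : B ⊆ s) :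
    IsCompact (⋃ y ∈ B, limitingGradients f y) := by
  set G := closure {p : E × E | DifferentiableAt ℝ f p.1 ∧ p.2 = gradient f p.1}
  have hc : IsCompact (G ∩ B ×ˢ Metric.closedBall (0 : E) K) :=
    (hB.prod (isCompact_closedBall _ _)).inter_left isClosed_closure
  convert hc.image continuous_snd
  ext v
  simp only [Set.mem_iUnion, exists_prop, Set.mem_image, Prod.exists, exists_eq_right]
  refine exists_congr fun y => ⟨fun ⟨hy, hv⟩ => ⟨mem_limitingGradients_iff.1 hv, hy, ?_⟩,
    fun ⟨hG, hy, _⟩ => ⟨hy, mem_limitingGradients_iff.2 hG⟩⟩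
  obtain ⟨u, -, hu, hg⟩ := hv
  rw [mem_closedBall_zero_iff]
  refine le_of_tendsto hg.norm ?_
  filter_upwards [hu.eventually (hs.mem_nhds (hBs hy))] with n hn
  exact norm_gradient_le_of_lipschitzOnWith hf (hs.mem_nhds hn)

theorem limitingGradients_nonempty {f : E → ℝ} {s : Set E} {K : NNReal}
    (hf : LipschitzOnWith K f s) (hs : IsOpen s) {x : E} (hx : x ∈ s) :
    (limitingGradients f x).Nonempty := by
  borelize E
  have hdense : x ∈ closure {y ∈ s | DifferentiableAt ℝ f y} := by
    rw [_root_.mem_closure_iff]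
    intro o ho hxo
    have hae := hf.ae_differentiableWithinAt_of_mem (μ := MeasureTheory.volume)
    have hd := MeasureTheory.Measure.dense_of_ae hae
    obtain ⟨y, ⟨hyo, hys⟩, hy⟩ := hd.inter_open_nonempty (o ∩ s) (ho.inter hs) ⟨x, hxo, hx⟩
    exact ⟨y, hyo, hys, (hy hys).differentiableAt (hs.mem_nhds hys)⟩
  obtain ⟨u, hu, hlim⟩ := mem_closure_iff_seq_limit.1 hdense
  obtain ⟨v, -, φ, hφ, hv⟩ := (isCompact_closedBall (0 : E) K).tendsto_subseq
    (x := fun n => gradient f (u n)) fun n => mem_closedBall_zero_iff.2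
      (norm_gradient_le_of_lipschitzOnWith hf (hs.mem_nhds (hu n).1))
  exact ⟨v, u ∘ φ, fun n => (hu _).2, hlim.comp hφ.tendsto_atTop, hv⟩

theorem goldsteinSubdiff_eq_of_lipschitzOnWith {f : E → ℝ} {s : Set E} {K : NNReal}
    (hf : LipschitzOnWith K f s) (hs : IsOpen s) {x : E} {ε : ℝ}
    (hx : Metric.closedBall x ε ⊆ s) :
    goldsteinSubdiff f x ε =
      convexHull ℝ (⋃ y ∈ Metric.closedBall x ε, limitingGradients f y) := by
  refine (convexHull_min (Set.iUnion₂_subset fun y hy => ?_) (convex_convexHull ℝ _)).antisymm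
    (convexHull_mono (Set.iUnion₂_mono fun y _ => ?_))
  · have hc : IsCompact (limitingGradients f y) := by
      simpa using isCompact_iUnion_limitingGradients hf hs isCompact_singleton
        (Set.singleton_subset_iff.2 (hx hy))
    rw [clarkeSubdiff_eq, (isCompact_convexHull_of_isCompact hc).isClosed.closure_eq]
    exact convexHull_mono (Set.subset_biUnion_of_mem hy)
  · exact (subset_convexHull ℝ _).trans subset_closure

theorem goldsteinGrad_mem {f : E → ℝ} {s : Set E} {K : NNReal}
    (hf : LipschitzOnWith K f s) (hs : IsOpen s) {x : E} {ε : ℝ} (hε : 0 ≤ ε)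
    (hx : Metric.closedBall x ε ⊆ s) :
    goldsteinGrad f x ε ∈
      convexHull ℝ (⋃ y ∈ Metric.closedBall x ε, limitingGradients f y) := by
  rw [goldsteinGrad, goldsteinSubdiff_eq_of_lipschitzOnWith hf hs hx]
  refine minNorm_mem (isCompact_convexHull_of_isCompact
    (isCompact_iUnion_limitingGradients hf hs (isCompact_closedBall x ε) hx)) ?_
  have hmem := Metric.mem_closedBall_self (x := x) hε
  obtain ⟨v, hv⟩ := limitingGradients_nonempty hf hs (hx hmem)
  exact ⟨v, subset_convexHull ℝ _ (Set.mem_biUnion hmem hv)⟩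

theorem exists_active_of_mem_limitingGradients {ι : Type*} [Finite ι] {f : E → ℝ}
    {F : ι → E → ℝ} {s : Set E} (hs : IsOpen s) (hf : Continuous f)
    (hF : ∀ i, ContDiff ℝ 1 (F i)) (hgrad : ∀ i, Continuous (gradient (F i)))
    (hle : ∀ x ∈ s, ∀ i, F i x ≤ f x) (hact : ∀ x ∈ s, ∃ i, F i x = f x)
    {y v : E} (hy : y ∈ s) (hv : v ∈ limitingGradients f y) :
    ∃ i, F i y = f y ∧ v = gradient (F i) y := by
  obtain ⟨u, hd, hu, hg⟩ := hv
  have hev : ∀ᶠ n in atTop, ∃ i, u n ∈ s ∧ F i (u n) = f (u n) := by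
    filter_upwards [hu.eventually (hs.mem_nhds hy)] with n hn
    obtain ⟨i, hi⟩ := hact _ hn
    exact ⟨i, hn, hi⟩
  obtain ⟨i, hi⟩ := Filter.frequently_exists.1 hev.frequently
  obtain ⟨φ, hφ, hi⟩ := extraction_of_frequently_atTop hi
  have hu' := hu.comp hφ.tendsto_atTop
  refine ⟨i, ?_, ?_⟩
  · refine tendsto_nhds_unique (((hF i).continuous.tendsto y).comp hu') ?_
    exact ((hf.tendsto y).comp hu').congr fun n => (hi n).2.symm
  · refine tendsto_nhds_unique (hg.comp hφ.tendsto_atTop) ?_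
    refine (((hgrad i).tendsto y).comp hu').congr fun n => ?_
    have hmin : IsLocalMin (fun x => f x - F i x) (u (φ n)) := by
      filter_upwards [hs.mem_nhds (hi n).1] with x hx
      have := hle x hx i
      have := (hi n).2
      linarith
    have hFd : DifferentiableAt ℝ (F i) (u (φ n)) := (hF i).differentiable one_ne_zero _
    have h0 := hmin.fderiv_eq_zero
    rw [fderiv_fun_sub (hd _) hFd, sub_eq_zero] at h0
    simp [gradient, h0]

theorem exists_stdSimplex_of_mem_convexHull_limitingGradients {ι : Type*} [Fintype ι]
    {f : E → ℝ} {F : ι → E → ℝ} {s : Set E} {K : NNReal} (hs : IsOpen s) (hf : Continuous f)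
    (hF : ∀ i, ContDiff ℝ 1 (F i)) (hgrad : ∀ i, Continuous (gradient (F i)))
    (hle : ∀ x ∈ s, ∀ i, F i x ≤ f x) (hact : ∀ x ∈ s, ∃ i, F i x = f x)
    (hfK : LipschitzOnWith K f s) (hFK : ∀ i, LipschitzOnWith K (F i) s)
    (hgK : ∀ i, LipschitzOnWith K (gradient (F i)) s)
    {x v : E} {ε : ℝ} (hε : 0 ≤ ε) (hx : Metric.closedBall x ε ⊆ s)
    (hv : v ∈ convexHull ℝ (⋃ y ∈ Metric.closedBall x ε, limitingGradients f y)) :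
    ∃ ν ∈ stdSimplex ℝ ι, ‖v - ∑ i, ν i • gradient (F i) x‖ ≤ K * ε ∧
      ∀ i, ν i ≠ 0 → f x - F i x ≤ 2 * K * ε := by
  have hxs : x ∈ s := hx (Metric.mem_closedBall_self hε)
  suffices h : convexHull ℝ (⋃ y ∈ Metric.closedBall x ε, limitingGradients f y) ⊆
      {v | ∃ ν ∈ stdSimplex ℝ ι, ‖v - ∑ i, ν i • gradient (F i) x‖ ≤ K * ε ∧
        ∀ i, ν i ≠ 0 → f x - F i x ≤ 2 * K * ε} from h hv
  refine convexHull_min (Set.iUnion₂_subset fun y hy w hw => ?_) ?_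
  · obtain ⟨i, hi, rfl⟩ :=
      exists_active_of_mem_limitingGradients hs hf hF hgrad hle hact (hx hy) hw
    have hyε : dist y x ≤ ε := hy
    refine ⟨Pi.single i 1, single_mem_stdSimplex ℝ i, ?_, fun j hj => ?_⟩
    · simp only [Pi.single_apply, ite_smul, one_smul, zero_smul, Finset.sum_ite_eq',
        Finset.mem_univ, if_true]
      rw [← dist_eq_norm]
      exact ((hgK i).dist_le_mul y (hx hy) x hxs).trans (by gcongr)
    · obtain rfl : j = i := by
        by_contra h
        simp [h] at hj
      have h1 := (hfK.dist_le_mul y (hx hy) x hxs).trans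
        (mul_le_mul_of_nonneg_left hyε K.coe_nonneg)
      have h2 := ((hFK j).dist_le_mul y (hx hy) x hxs).trans
        (mul_le_mul_of_nonneg_left hyε K.coe_nonneg)
      rw [Real.dist_eq, abs_le] at h1 h2
      linarith
  · rintro v ⟨ν, hν, hvν, hνs⟩ w ⟨μ, hμ, hwμ, hμs⟩ a b ha hb hab
    refine ⟨a • ν + b • μ, convex_stdSimplex ℝ ι hν hμ ha hb hab, ?_, fun i hi => ?_⟩
    · have : a • v + b • w - ∑ i, (a • ν + b • μ) i • gradient (F i) x =
          a • (v - ∑ i, ν i • gradient (F i) x) + b • (w - ∑ i, μ i • gradient (F i) x) := by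
        simp only [Pi.add_apply, Pi.smul_apply, smul_eq_mul, add_smul, mul_smul,
          Finset.sum_add_distrib, ← Finset.smul_sum, smul_sub]
        abel
      rw [this]
      refine (norm_add_le _ _).trans ?_
      rw [norm_smul, norm_smul, Real.norm_of_nonneg ha, Real.norm_of_nonneg hb]
      calc _ ≤ a * (K * ε) + b * (K * ε) := by gcongr
        _ = K * ε := by rw [← add_mul, hab, one_mul]
    · by_cases hi' : ν i = 0
      · exact hμs i fun h => hi (by simp [hi', h])
      · exact hνs i hi'

theorem ContDiff.gradient_of_two {V : Type*} [NormedAddCommGroup V] [InnerProductSpace ℝ V] [CompleteSpace V]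
    {f : V → ℝ} (hf : ContDiff ℝ 2 f) :
    ContDiff ℝ 1 (gradient f) :=
  (InnerProductSpace.toDual ℝ V).symm.toContinuousLinearEquiv.contDiff.comp
    (hf.fderiv_right (m := 1) (by norm_num))

/-- Near `xbar`, a Goldstein subgradient of norm at most its radius produces
multipliers that nearly annihilate the gradients and live on nearly active functions. -/
theorem exists_multipliers_of_goldsteinGrad_le {ι : Type*} [Fintype ι] {f : E → ℝ}
    {F : ι → E → ℝ} {xbar : E} {ρ : ℝ} (hρ : 0 < ρ) (hf : LocallyLipschitz f)
    (hF : ∀ i, ContDiff ℝ 2 (F i)) (hle : ∀ x, ‖x - xbar‖ ≤ ρ → ∀ i, F i x ≤ f x)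
    (hact : ∀ x, ‖x - xbar‖ ≤ ρ → ∃ i, F i x = f x) :
    ∃ C > 0, ∃ r > 0, ∀ x ε, 0 ≤ ε → ‖x - xbar‖ + ε < r → ‖goldsteinGrad f x ε‖ ≤ ε →
      ∃ ν ∈ stdSimplex ℝ ι, ‖∑ i, ν i • gradient (F i) x‖ ≤ C * ε ∧
        ∀ i j, ν i ≠ 0 → ν j ≠ 0 → |F i x - F j x| ≤ C * ε := by
  have hg i := (hF i).gradient_of_two
  obtain ⟨K₀, t₀, ht₀, hK₀⟩ := hf xbar
  choose K₁ t₁ ht₁ hK₁ using fun i =>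
    ((hF i).of_le one_le_two).contDiffAt.exists_lipschitzOnWith (x := xbar)
  choose K₂ t₂ ht₂ hK₂ using fun i => (hg i).contDiffAt.exists_lipschitzOnWith (x := xbar)
  have hev : ∀ᶠ x in 𝓝 xbar, x ∈ t₀ ∧ (∀ i, x ∈ t₁ i) ∧ (∀ i, x ∈ t₂ i) ∧
      x ∈ Metric.closedBall xbar ρ :=
    Filter.Eventually.and ht₀ <| (Filter.eventually_all.2 ht₁).and <|
      (Filter.eventually_all.2 ht₂).and <| Metric.closedBall_mem_nhds _ hρ
  obtain ⟨r, hr, hball⟩ := Metric.eventually_nhds_iff_ball.1 hev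
  set K : NNReal := K₀ + ∑ i, K₁ i + ∑ i, K₂ i with hK
  have hle₁ i : K₁ i ≤ K := by
    have := Finset.single_le_sum (f := K₁) (fun _ _ => zero_le) (Finset.mem_univ i)
    exact this.trans (by rw [hK, add_assoc]; exact le_add_left le_self_add)
  have hle₂ i : K₂ i ≤ K := by
    have := Finset.single_le_sum (f := K₂) (fun _ _ => zero_le) (Finset.mem_univ i)
    exact this.trans le_add_self
  have hfK : LipschitzOnWith K f (Metric.ball xbar r) :=
    (hK₀.mono fun x hx => (hball x hx).1).weaken (by rw [hK, add_assoc]; exact le_self_add)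
  refine ⟨1 + 2 * K, by positivity, r, hr, fun x ε hε hxr hgε => ?_⟩
  have hsub : Metric.closedBall x ε ⊆ Metric.ball xbar r := by
    refine Metric.closedBall_subset_ball' ?_
    rw [dist_eq_norm]
    linarith
  have hxs : x ∈ Metric.ball xbar r := hsub (Metric.mem_closedBall_self hε)
  have hρ' {y : E} (hy : y ∈ Metric.ball xbar r) : ‖y - xbar‖ ≤ ρ :=
    mem_closedBall_iff_norm.1 (hball y hy).2.2.2
  obtain ⟨ν, hν, hν1, hν2⟩ := exists_stdSimplex_of_mem_convexHull_limitingGradients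
    Metric.isOpen_ball hf.continuous (fun i => (hF i).of_le one_le_two)
    (fun i => (hg i).continuous) (fun y hy => hle y (hρ' hy)) (fun y hy => hact y (hρ' hy)) hfK
    (fun i => ((hK₁ i).mono fun y hy => (hball y hy).2.1 i).weaken (hle₁ i))
    (fun i => ((hK₂ i).mono fun y hy => (hball y hy).2.2.1 i).weaken (hle₂ i))
    hε hsub (goldsteinGrad_mem hfK Metric.isOpen_ball hε hsub)
  have hKε : 0 ≤ (K : ℝ) * ε := by positivity
  refine ⟨ν, hν, ?_, fun i j hi hj => ?_⟩
  · have := norm_sub_le (goldsteinGrad f x ε) (goldsteinGrad f x ε - ∑ i, ν i • gradient (F i) x)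
    rw [sub_sub_cancel] at this
    linarith
  · have h1 := hν2 i hi
    have h2 := hν2 j hj
    have h3 := hle x (hρ' hxs) i
    have h4 := hle x (hρ' hxs) j
    rw [abs_le]
    constructor <;> linarith

theorem exists_weights_pos_of_zero_mem_intrinsicInterior {V : Type*} [NormedAddCommGroup V] [NormedSpace ℝ V]
    {ι : Type*} [Fintype ι] {g : ι → V}
    (h0 : (0 : V) ∈ intrinsicInterior ℝ (convexHull ℝ (Set.range g))) (i : ι) :
    ∃ w : ι → ℝ, ∑ j, w j = 1 ∧ ∑ j, w j • g j = 0 ∧ 0 < w i := by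
  obtain ⟨y, hy, hy0⟩ := mem_intrinsicInterior.1 h0
  have hgi : g i ∈ affineSpan ℝ (convexHull ℝ (Set.range g)) :=
    subset_affineSpan ℝ _ (subset_convexHull ℝ _ ⟨i, rfl⟩)
  let γ (t : ℝ) : affineSpan ℝ (convexHull ℝ (Set.range g)) :=
    ⟨AffineMap.lineMap (0 : V) (g i) (-t), AffineMap.lineMap_mem _ (hy0 ▸ y.2) hgi⟩
  have hγ : Continuous γ := by
    refine Continuous.subtype_mk ?_ _
    simp only [AffineMap.lineMap_apply_module]
    fun_prop
  have hγ0 : γ 0 = y := Subtype.ext (by simp [γ, hy0])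
  have hev : ∀ᶠ t in 𝓝 (0 : ℝ), (γ t : V) ∈ convexHull ℝ (Set.range g) :=
    (hγ.tendsto 0).eventually (hγ0 ▸ mem_interior_iff_mem_nhds.1 hy)
  obtain ⟨t, ht, htpos⟩ :=
    ((hev.filter_mono nhdsWithin_le_nhds).and (self_mem_nhdsWithin (s := Set.Ioi (0 : ℝ)))).exists
  have htpos : 0 < t := htpos
  have hsub : convexHull ℝ (Set.range g) ⊆ Fintype.linearCombination ℝ g '' stdSimplex ℝ ι := by
    refine convexHull_min ?_ ((convex_stdSimplex ℝ ι).linear_image _)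
    rintro _ ⟨j, rfl⟩
    exact ⟨Pi.single j 1, single_mem_stdSimplex ℝ j, by simp⟩
  obtain ⟨μ, hμ, hμt⟩ := hsub ht
  have hμt : ∑ j, μ j • g j = -t • g i := by
    simpa [γ, AffineMap.lineMap_apply_module, Fintype.linearCombination_apply] using hμt
  have h1t : 0 < 1 + t := by linarith
  refine ⟨(1 + t)⁻¹ • (μ + Pi.single i t), ?_, ?_, ?_⟩
  · simp only [Pi.smul_apply, Pi.add_apply, smul_eq_mul, ← Finset.mul_sum,
      Finset.sum_add_distrib, hμ.2, Finset.sum_pi_single', Finset.mem_univ, if_true]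
    field_simp
  · simp only [Pi.smul_apply, Pi.add_apply, smul_assoc, ← Finset.smul_sum, add_smul,
      Finset.sum_add_distrib, hμt, Pi.single_apply, ite_smul, zero_smul, Finset.sum_ite_eq',
      Finset.mem_univ, if_true]
    simp
  · have := hμ.1 i
    simp only [Pi.smul_apply, Pi.add_apply, Pi.single_eq_same, smul_eq_mul]
    positivity

theorem AffineIndependent.exists_inner_add_eq {ι : Type*} [Nonempty ι] {g : ι → E}
    (hg : AffineIndependent ℝ g) (a : ι → ℝ) : ∃ (z : E) (s : ℝ), ∀ i, ⟪g i, z⟫ + a i = s := by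
  obtain ⟨i₀⟩ := ‹Nonempty ι›
  have hli := (affineIndependent_iff_linearIndependent_vsub ℝ g i₀).1 hg
  obtain ⟨φ, hφ⟩ := LinearMap.exists_extend
    ((Module.Basis.span hli).constr ℝ fun i : {i // i ≠ i₀} => a i₀ - a i)
  set z := (InnerProductSpace.toDual ℝ E).symm (LinearMap.toContinuousLinearMap φ)
  refine ⟨z, ⟪g i₀, z⟫ + a i₀, fun i => ?_⟩
  by_cases hi : i = i₀
  · rw [hi]
  have hz : ⟪g i - g i₀, z⟫ = a i₀ - a i := by
    rw [real_inner_comm, InnerProductSpace.toDual_symm_apply]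
    have hb := (Module.Basis.span hli).constr_basis ℝ
      (fun i : {i // i ≠ i₀} => a i₀ - a i) ⟨i, hi⟩
    rw [← hφ] at hb
    simpa [Module.Basis.span_apply] using hb
  rw [inner_sub_left] at hz
  linarith

theorem eventually_sub_le_of_hasDerivAt_deriv {φ φ' : ℝ → ℝ} {q q' : ℝ}
    (hφ : ∀ t, HasDerivAt φ (φ' t) t) (hφ' : HasDerivAt φ' q 0) (h0 : φ' 0 = 0) (hq : q < q') :
    ∀ᶠ t in 𝓝[>] (0 : ℝ), φ t - φ 0 ≤ q' / 2 * t ^ 2 := by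
  have hslope : ∀ᶠ t in 𝓝[>] (0 : ℝ), φ' t ≤ q' * t := by
    have := (hasDerivAt_iff_tendsto_slope.1 hφ').mono_left
      (nhdsWithin_mono (0 : ℝ) fun t (ht : t ∈ Set.Ioi 0) => (ne_of_gt ht : t ≠ 0))
    filter_upwards [this.eventually_lt_const hq, self_mem_nhdsWithin] with t ht (htpos : 0 < t)
    rw [slope_def_field, h0, sub_zero, sub_zero, div_lt_iff₀ htpos] at ht
    exact ht.le
  obtain ⟨δ, hδ, hsub⟩ := mem_nhdsGT_iff_exists_Ioo_subset.1 hslope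
  filter_upwards [Ioo_mem_nhdsGT hδ] with t ht
  have hψ (c : ℝ) : HasDerivAt (fun t => φ t - q' / 2 * t ^ 2) (φ' c - q' * c) c := by
    refine ((hφ c).fun_sub ((hasDerivAt_pow 2 c).const_mul (q' / 2))).congr_deriv ?_
    simp only [Nat.cast_ofNat, Nat.add_one_sub_one, pow_one]
    ring
  obtain ⟨c, hc, hslope⟩ := exists_hasDerivAt_eq_slope (fun t => φ t - q' / 2 * t ^ 2)
    (fun c => φ' c - q' * c) ht.1 (fun c _ => (hψ c).continuousAt.continuousWithinAt)
    fun c _ => hψ c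
  have hc' : φ' c ≤ q' * c := hsub ⟨hc.1, hc.2.trans ht.2⟩
  rw [eq_div_iff (by linarith [ht.1])] at hslope
  have := mul_nonneg (sub_nonneg.2 hc') ht.1.le
  nlinarith

/-- Quadratic growth makes the Hessian of the Lagrangian positive definite on the orthogonal
complement of the gradients. -/
theorem sum_inner_fderiv_gradient_pos {ι : Type*} [Fintype ι] [Nonempty ι] {f : E → ℝ}
    {F : ι → E → ℝ} {xbar : E} (hF : ∀ i, ContDiff ℝ 2 (F i)) (hbar : ∀ i, F i xbar = f xbar)
    (hact : ∀ᶠ x in 𝓝 xbar, ∃ i, F i x = f x)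
    (hind : AffineIndependent ℝ fun i => gradient (F i) xbar)
    {δ : ℝ} (hδ : 0 < δ) (hgrowth : ∀ᶠ x in 𝓝 xbar, f x - f xbar ≥ δ / 2 * ‖x - xbar‖ ^ 2)
    {ν : ι → ℝ} (hν1 : ∑ i, ν i = 1) (hν0 : ∑ i, ν i • gradient (F i) xbar = 0)
    {d : E} (hd : d ≠ 0) (hgd : ∀ i, ⟪gradient (F i) xbar, d⟫ = 0) :
    0 < ∑ i, ν i * ⟪fderiv ℝ (gradient (F i)) xbar d, d⟫ := by
  by_contra! hQ
  obtain ⟨z, s, hz⟩ := hind.exists_inner_add_eq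
    fun i => ⟪fderiv ℝ (gradient (F i)) xbar d, d⟫ / 2
  have hs : s ≤ 0 := by
    have h1 : ∑ i, ν i * (⟪gradient (F i) xbar, z⟫ +
        ⟪fderiv ℝ (gradient (F i)) xbar d, d⟫ / 2) = s := by
      simp_rw [hz, ← Finset.sum_mul, hν1, one_mul]
    have h2 : ∑ i, ν i * ⟪gradient (F i) xbar, z⟫ = 0 := by
      simp_rw [← real_inner_smul_left, ← sum_inner, hν0, inner_zero_left]
    simp_rw [mul_add, Finset.sum_add_distrib, h2, ← mul_div_assoc, ← Finset.sum_div] at h1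
    linarith
  let γ (t : ℝ) : E := xbar + (t • d + t ^ 2 • z)
  have hγ (t : ℝ) : HasDerivAt γ (d + (2 * t) • z) t := by
    have h1 := ((hasDerivAt_id t).smul_const d).add ((hasDerivAt_pow 2 t).smul_const z)
    simpa [γ] using h1.const_add xbar
  have hγ0 : γ 0 = xbar := by simp [γ]
  have hγt : Tendsto γ (𝓝[>] 0) (𝓝 xbar) := by
    have := (hγ 0).continuousAt.tendsto
    rw [hγ0] at this
    exact this.mono_left nhdsWithin_le_nhds
  have hdpos : 0 < ‖d‖ ^ 2 := by positivity
  have hupper : ∀ᶠ t in 𝓝[>] (0 : ℝ), ∀ i,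
      F i (γ t) - f xbar ≤ (δ * ‖d‖ ^ 2 / 4) / 2 * t ^ 2 := by
    refine Filter.eventually_all.2 fun i => ?_
    have hφ (t : ℝ) : HasDerivAt (fun t => F i (γ t))
        ⟪gradient (F i) (γ t), d + (2 * t) • z⟫ t := by
      rw [inner_gradient_left]
      exact (((hF i).differentiable two_ne_zero) (γ t)).hasFDerivAt.comp_hasDerivAt t (hγ t)
    have hG : HasDerivAt (fun t => gradient (F i) (γ t)) (fderiv ℝ (gradient (F i)) xbar d) 0 := by
      have h1 := ((hF i).gradient_of_two.differentiable one_ne_zero (γ 0)).hasFDerivAt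
      simpa [hγ0, Function.comp_def] using h1.comp_hasDerivAt 0 (hγ 0)
    have hz' : HasDerivAt (fun t : ℝ => d + (2 * t) • z) ((2 : ℝ) • z) 0 := by
      have := (((hasDerivAt_id (0 : ℝ)).const_mul 2).smul_const z).const_add d
      simpa using this
    have hφ' := hG.inner ℝ hz'
    simp only [hγ0, mul_zero, zero_smul, add_zero, inner_smul_right] at hφ'
    have := eventually_sub_le_of_hasDerivAt_deriv (q' := δ * ‖d‖ ^ 2 / 4) hφ hφ'
      (by simp [hγ0, hgd]) (by linarith [hz i, mul_pos hδ hdpos])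
    simpa [hγ0, hbar] using this
  have hlower : ∀ᶠ t in 𝓝[>] (0 : ℝ), ‖d‖ ^ 2 / 2 < ‖d + t • z‖ ^ 2 := by
    have : Tendsto (fun t : ℝ => ‖d + t • z‖ ^ 2) (𝓝 0) (𝓝 (‖d + (0 : ℝ) • z‖ ^ 2)) :=
      Continuous.tendsto (by fun_prop) 0
    refine (this.mono_left nhdsWithin_le_nhds).eventually_const_lt ?_
    simpa using half_lt_self hdpos
  obtain ⟨t, hup, hlow, ⟨i, hi⟩, hgr, htpos⟩ := (hupper.and <| hlower.and <|
    (hγt.eventually hact).and <| (hγt.eventually hgrowth).and self_mem_nhdsWithin).exists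
  have htpos : 0 < t := htpos
  have hnorm : ‖γ t - xbar‖ ^ 2 = t ^ 2 * ‖d + t • z‖ ^ 2 := by
    have : γ t - xbar = t • (d + t • z) := by
      simp only [γ, add_sub_cancel_left, smul_add, smul_smul, pow_two]
    rw [this, norm_smul, mul_pow, Real.norm_eq_abs, sq_abs]
  have h1 := hup i
  rw [hi] at h1
  rw [hnorm] at hgr
  have ht2 : 0 < δ * t ^ 2 := by positivity
  nlinarith [mul_lt_mul_of_pos_left hlow ht2, mul_pos ht2 hdpos]

theorem DifferentiableAt.tendsto_inv_norm_smul_sub {V : Type*} [NormedAddCommGroup V] [NormedSpace ℝ V]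
    {G : Type*}
    [NormedAddCommGroup G] [NormedSpace ℝ G] {h : V → G} {xbar d : V}
    (hh : DifferentiableAt ℝ h xbar) {x : ℕ → V} (hx : Tendsto x atTop (𝓝 xbar))
    (hd : Tendsto (fun k => ‖x k - xbar‖⁻¹ • (x k - xbar)) atTop (𝓝 d)) :
    Tendsto (fun k => ‖x k - xbar‖⁻¹ • (h (x k) - h xbar)) atTop (𝓝 (fderiv ℝ h xbar d)) := by
  have h0 : Tendsto (fun k => x k - xbar) atTop (𝓝 0) := by
    simpa using hx.sub_const xbar
  simpa using (hasFDerivWithinAt_univ.2 hh.hasFDerivAt).lim h0 (.of_forall fun _ => mem_univ _) hd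

theorem false_of_tendsto_multipliers {ι : Type*} [Fintype ι] [Nonempty ι] {f : E → ℝ}
    {F : ι → E → ℝ} {xbar : E} (hF : ∀ i, ContDiff ℝ 2 (F i)) (hbar : ∀ i, F i xbar = f xbar)
    (hact : ∀ᶠ x in 𝓝 xbar, ∃ i, F i x = f x)
    (hind : AffineIndependent ℝ fun i => gradient (F i) xbar)
    (hint : (0 : E) ∈ intrinsicInterior ℝ
      (convexHull ℝ (Set.range fun i => gradient (F i) xbar)))
    {δ : ℝ} (hδ : 0 < δ) (hgrowth : ∀ᶠ x in 𝓝 xbar, f x - f xbar ≥ δ / 2 * ‖x - xbar‖ ^ 2)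
    {x : ℕ → E} {ν : ℕ → ι → ℝ} {e : ℕ → ℝ} (hx : Tendsto x atTop (𝓝 xbar))
    (hne : ∀ k, x k ≠ xbar) (he : Tendsto e atTop (𝓝 0)) (hν : ∀ k, ν k ∈ stdSimplex ℝ ι)
    (hsum : ∀ k, ‖∑ i, ν k i • gradient (F i) (x k)‖ ≤ e k * ‖x k - xbar‖)
    (hdiff : ∀ k i j, ν k i ≠ 0 → ν k j ≠ 0 →
      |F i (x k) - F j (x k)| ≤ e k * ‖x k - xbar‖) : False := by
  have hr (k : ℕ) : 0 < ‖x k - xbar‖ := norm_pos_iff.2 (sub_ne_zero.2 (hne k))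
  obtain ⟨⟨d, μ⟩, ⟨hd, hμ⟩, φ, hφ, hlim⟩ :=
    ((isCompact_sphere (0 : E) 1).prod (isCompact_stdSimplex ℝ ι)).tendsto_subseq
      (x := fun k => (‖x k - xbar‖⁻¹ • (x k - xbar), ν k))
      fun k => ⟨by simp [norm_smul, (hr k).ne'], hν k⟩
  change d ∈ _ at hd
  change μ ∈ _ at hμ
  have hd0 : d ≠ 0 := ne_zero_of_mem_unit_sphere ⟨d, hd⟩
  have hdlim : Tendsto (fun k => ‖x (φ k) - xbar‖⁻¹ • (x (φ k) - xbar)) atTop (𝓝 d) :=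
    (continuous_fst.tendsto _).comp hlim
  have hνlim (i : ι) : Tendsto (fun k => ν (φ k) i) atTop (𝓝 (μ i)) :=
    (((continuous_apply i).comp continuous_snd).tendsto (d, μ)).comp hlim
  have hxφ : Tendsto (fun k => x (φ k)) atTop (𝓝 xbar) := hx.comp hφ.tendsto_atTop
  have heφ : Tendsto (fun k => e (φ k)) atTop (𝓝 0) := he.comp hφ.tendsto_atTop
  have hg i : ContDiff ℝ 1 (gradient (F i)) := (hF i).gradient_of_two
  have hμ0 : ∑ i, μ i • gradient (F i) xbar = 0 := by
    have h1 : Tendsto (fun k => ∑ i, ν (φ k) i • gradient (F i) (x (φ k))) atTop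
        (𝓝 (∑ i, μ i • gradient (F i) xbar)) :=
      tendsto_finsetSum _ fun i _ =>
        (hνlim i).smul (((hg i).continuous.tendsto xbar).comp hxφ)
    refine tendsto_nhds_unique h1 (squeeze_zero_norm (fun k => hsum (φ k)) ?_)
    simpa using heφ.mul (hxφ.sub_const xbar).norm
  have hμpos (i : ι) : 0 < μ i := by
    obtain ⟨w, hw1, hw0, hwi⟩ := exists_weights_pos_of_zero_mem_intrinsicInterior hint i
    rwa [hind.eq_of_sum_eq_sum (hμ.2.trans hw1.symm) (hμ0.trans hw0.symm) i (Finset.mem_univ i)]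
  have hνne : ∀ᶠ k in atTop, ∀ i, ν (φ k) i ≠ 0 :=
    Filter.eventually_all.2 fun i => (hνlim i).eventually_ne (hμpos i).ne'
  have hgdeq (i j : ι) : ⟪gradient (F i) xbar, d⟫ = ⟪gradient (F j) xbar, d⟫ := by
    have hdiffF i : DifferentiableAt ℝ (F i) xbar := (hF i).differentiable two_ne_zero _
    have h1 := ((hdiffF i).tendsto_inv_norm_smul_sub hxφ hdlim).sub
      ((hdiffF j).tendsto_inv_norm_smul_sub hxφ hdlim)
    rw [← sub_eq_zero, inner_gradient_left, inner_gradient_left]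
    refine tendsto_nhds_unique h1 (squeeze_zero_norm' ?_ heφ)
    filter_upwards [hνne] with k hk
    have := hdiff (φ k) i j (hk i) (hk j)
    rw [← smul_sub, hbar i, hbar j, sub_sub_sub_cancel_right, norm_smul, norm_inv, norm_norm,
      Real.norm_eq_abs, inv_mul_le_iff₀ (hr _), mul_comm]
    exact this
  have hgd (i : ι) : ⟪gradient (F i) xbar, d⟫ = 0 := by
    have h1 : ∑ j, μ j * ⟪gradient (F j) xbar, d⟫ = 0 := by
      simp_rw [← real_inner_smul_left, ← sum_inner, hμ0, inner_zero_left]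
    simp_rw [hgdeq _ i, ← Finset.sum_mul, hμ.2, one_mul] at h1
    exact h1
  refine (sum_inner_fderiv_gradient_pos hF hbar hact hind hδ hgrowth hμ.2 hμ0 hd0 hgd).ne' ?_
  have h1 : Tendsto (fun k => ∑ i, ν (φ k) i *
      ⟪‖x (φ k) - xbar‖⁻¹ • (gradient (F i) (x (φ k)) - gradient (F i) xbar), d⟫) atTop
      (𝓝 (∑ i, μ i * ⟪fderiv ℝ (gradient (F i)) xbar d, d⟫)) :=
    tendsto_finsetSum _ fun i _ => (hνlim i).mul <|
      (((hg i).differentiable one_ne_zero xbar).tendsto_inv_norm_smul_sub hxφ hdlim).inner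
        tendsto_const_nhds
  refine tendsto_nhds_unique h1 (squeeze_zero_norm (fun k => ?_) heφ)
  have h2 : ∑ i, ν (φ k) i *
      ⟪‖x (φ k) - xbar‖⁻¹ • (gradient (F i) (x (φ k)) - gradient (F i) xbar), d⟫ =
      ‖x (φ k) - xbar‖⁻¹ * ⟪∑ i, ν (φ k) i • gradient (F i) (x (φ k)), d⟫ := by
    rw [sum_inner, Finset.mul_sum]
    refine Finset.sum_congr rfl fun i _ => ?_
    rw [real_inner_smul_left, inner_sub_left, hgd, sub_zero, real_inner_smul_left]
    ring
  have h3 : ‖d‖ = 1 := mem_sphere_zero_iff_norm.1 hd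
  have h4 := norm_inner_le_norm (𝕜 := ℝ) (∑ i, ν (φ k) i • gradient (F i) (x (φ k))) d
  rw [h3, mul_one] at h4
  rw [h2, norm_mul, norm_inv, norm_norm, inv_mul_le_iff₀ (hr _), mul_comm]
  exact h4.trans (hsum _)

theorem stmt17 (f : E → ℝ) (hf : LocallyLipschitz f) (xbar : E) {n : ℕ}
    (F : Fin (n + 1) → E → ℝ) (hF : IsStrongC2MaxAt f xbar F) :
    ∃ α > 0, ∃ ρ > 0, ∀ x : E, ‖x - xbar‖ ≤ ρ →
      α * ‖x - xbar‖ ≤ goldsteinModulus f x := by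
  obtain ⟨hC2, ⟨ρ, hρ, hmax⟩, heq, hind, hint, δ, hδ, ρ', hρ', hgrowth⟩ := hF
  have hle (x : E) (hx : ‖x - xbar‖ ≤ ρ) (i) : F i x ≤ f x := by
    rw [hmax x hx]
    exact Finset.le_sup' (fun i => F i x) (Finset.mem_univ i)
  have hact (x : E) (hx : ‖x - xbar‖ ≤ ρ) : ∃ i, F i x = f x := by
    obtain ⟨i, -, hi⟩ := Finset.exists_mem_eq_sup' Finset.univ_nonempty fun i => F i x
    exact ⟨i, by rw [hmax x hx, hi]⟩
  have hbar (i) : F i xbar = f xbar := by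
    obtain ⟨j, hj⟩ := hact xbar (by simpa using hρ.le)
    rw [heq i j, hj]
  have hnear {r : ℝ} (hr : 0 < r) : ∀ᶠ x in 𝓝 xbar, ‖x - xbar‖ ≤ r := by
    filter_upwards [Metric.closedBall_mem_nhds xbar hr] with x hx
    exact mem_closedBall_iff_norm.1 hx
  obtain ⟨C, hC, r, hr, hmult⟩ := exists_multipliers_of_goldsteinGrad_le hρ hf hC2 hle hact
  by_contra! hcon
  have hpt (k : ℕ) : ∃ x : E, ∃ ν ∈ stdSimplex ℝ (Fin (n + 1)),
      ‖x - xbar‖ ≤ r / 3 * (1 / ((k : ℝ) + 1)) ∧ x ≠ xbar ∧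
      ‖∑ i, ν i • gradient (F i) x‖ ≤ C * (1 / ((k : ℝ) + 1)) * ‖x - xbar‖ ∧
      ∀ i j, ν i ≠ 0 → ν j ≠ 0 → |F i x - F j x| ≤ C * (1 / ((k : ℝ) + 1)) * ‖x - xbar‖ := by
    have hk : 0 < 1 / ((k : ℝ) + 1) := Nat.one_div_pos_of_nat
    have hk1 : 1 / ((k : ℝ) + 1) ≤ 1 := by
      rw [div_le_one (by positivity)]
      linarith [k.cast_nonneg (α := ℝ)]
    obtain ⟨x, hx, hΓ⟩ := hcon _ hk (r / 3 * (1 / ((k : ℝ) + 1))) (by positivity)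
    obtain ⟨ε, ⟨hε, hgε⟩, hlt⟩ := exists_lt_of_csInf_lt (goldsteinModulus_set_nonempty f x) hΓ
    have hxr : ‖x - xbar‖ ≤ r / 3 := hx.trans (mul_le_of_le_one_right (by positivity) hk1)
    have hεx : ε ≤ ‖x - xbar‖ := hlt.le.trans (mul_le_of_le_one_left (norm_nonneg _) hk1)
    obtain ⟨ν, hν, h1, h2⟩ := hmult x ε hε (by linarith) hgε
    have hCε : C * ε ≤ C * (1 / ((k : ℝ) + 1)) * ‖x - xbar‖ := by
      rw [mul_assoc]
      gcongr
    refine ⟨x, ν, hν, hx, ?_, h1.trans hCε, fun i j hi hj => (h2 i j hi hj).trans hCε⟩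
    rintro rfl
    simp only [sub_self, norm_zero, mul_zero] at hlt
    linarith
  choose x ν hν hx hne hsum hdiff using hpt
  have hlim := tendsto_one_div_add_atTop_nhds_zero_nat (𝕜 := ℝ)
  have hxlim : Tendsto x atTop (𝓝 xbar) := by
    rw [tendsto_iff_norm_sub_tendsto_zero]
    refine squeeze_zero (fun k => norm_nonneg _) hx ?_
    simpa using hlim.const_mul (r / 3)
  refine false_of_tendsto_multipliers hC2 hbar ((hnear hρ).mono hact) hind hint hδ
    ((hnear hρ').mono hgrowth) hxlim hne ?_ hν hsum hdiff
  simpa using hlim.const_mul C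
end
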